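/- arXiv:1010.0898 — 2 statements merged into one kernel-verified Lean document; each statement's English description precedes it below -/
import Mathlib

section
/- Let k, k' ≥ 1 be integers, let b, b' > 0 and 0 ≤ c ≤ b be real numbers, and let 0 < ρ₁ < ρ₂ be radii. Then S(k, k', b, b', c) = −(1/(2π²)) · ∮_{|z|=ρ₁} ∮_{|w|=ρ₂} (z + b/z)^{k} · (w + b'/w)^{k'} · (c/b) · ((c/b)·z − w)^{−2} dw dz, where ∮_{|z|=ρ} denotes the counterclockwise contour integral over the circle of radius ρ centered at 0 (including the factor dz), and the constant arises as 2/(2πi)² = −1/(2π²). -/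
open MeasureTheory Complex Real

/-- The limiting covariance `S(k,k',b,b',c)`: the sum over integers `r ≥ 1` with
`r ≤ min(k,k')`, `r ≡ k (mod 2)` and `r ≡ k' (mod 2)` of
`2r · binom(k,(k−r)/2) · binom(k',(k'−r)/2) · c^r · b^((k−r)/2) · b'^((k'−r)/2)`. -/
noncomputable def Sker (k k' : ℕ) (b b' c : ℝ) : ℝ :=
  ∑ r ∈ Finset.Icc 1 (min k k'),
    if r % 2 = k % 2 ∧ r % 2 = k' % 2 then
      2 * r * (k.choose ((k - r) / 2)) * (k'.choose ((k' - r) / 2)) *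
        c ^ r * b ^ ((k - r) / 2) * b' ^ ((k' - r) / 2)
    else 0

lemma aux_sum {R : ℝ} (s : Finset ℕ) (a : ℕ → ℂ) (f : ℕ → ℂ → ℂ)
    (hf : ∀ i, CircleIntegrable (f i) 0 R) :
    (∮ z in C(0, R), ∑ i ∈ s, a i * f i z) = ∑ i ∈ s, a i * ∮ z in C(0, R), f i z := by
  have h : ∀ i ∈ s, CircleIntegrable (fun z => a i * f i z) 0 R :=
    fun i _ => (hf i).const_smul (a := a i)
  rw [circleIntegral.integral_fun_sum h]
  simp only [circleIntegral.integral_const_mul]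

lemma aux_expand (k : ℕ) (b w : ℂ) (hw : w ≠ 0) :
    (w + b / w) ^ k = ∑ j ∈ Finset.range (k + 1),
      ((k.choose j : ℂ) * b ^ j) * w ^ ((k : ℤ) - 2 * j) := by
  rw [add_comm, add_pow]
  refine Finset.sum_congr rfl fun j hj => ?_
  have hj' : j ≤ k := by simpa [Nat.lt_succ_iff] using hj
  have : w ^ ((k : ℤ) - 2 * j) = w ^ (k - j) * (w ^ j)⁻¹ := by
    rw [show (k : ℤ) - 2 * j = ((k - j : ℕ) : ℤ) + (-(j : ℤ)) by push_cast [hj']; ring,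
      zpow_add₀ hw, zpow_natCast, zpow_neg, zpow_natCast]
  rw [this, div_pow]
  ring

lemma aux_ne {R : ℝ} {u w : ℂ} (hu : ‖u‖ < R) (hw : w ∈ Metric.sphere (0 : ℂ) R) :
    w ≠ 0 ∧ w - u ≠ 0 := by
  have hw' : ‖w‖ = R := by simpa using hw
  refine ⟨?_, ?_⟩
  · rintro rfl
    have := norm_nonneg u
    simp at hw'
    linarith
  · intro h
    rw [sub_eq_zero] at h
    subst h
    linarith

lemma aux_int {R : ℝ} {u : ℂ} (hu : ‖u‖ < R) (n m : ℤ) :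
    CircleIntegrable (fun w => w ^ n * (w - u) ^ m) 0 R := by
  have hR : 0 ≤ R := (norm_nonneg u).trans hu.le
  apply ContinuousOn.circleIntegrable hR
  intro w hw
  obtain ⟨h1, h2⟩ := aux_ne hu hw
  apply ContinuousAt.continuousWithinAt
  exact (continuousAt_zpow₀ w n (Or.inl h1)).mul
    (ContinuousAt.zpow₀ (by fun_prop) m (Or.inl h2))

lemma aux_rec {R : ℝ} {u : ℂ} (hu : ‖u‖ < R) (n m : ℤ) :
    (∮ w in C(0, R), w ^ (n + 1) * (w - u) ^ m) =
      u * (∮ w in C(0, R), w ^ n * (w - u) ^ m) +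
        ∮ w in C(0, R), w ^ n * (w - u) ^ (m + 1) := by
  have hR : 0 ≤ R := (norm_nonneg u).trans hu.le
  have hi : CircleIntegrable (fun w => u * (w ^ n * (w - u) ^ m)) 0 R :=
    (aux_int hu n m).const_smul (a := u)
  rw [← circleIntegral.integral_const_mul, ← circleIntegral.integral_add hi (aux_int hu n (m + 1))]
  refine circleIntegral.integral_congr hR fun w hw => ?_
  obtain ⟨h1, h2⟩ := aux_ne hu hw
  simp only [zpow_add_one₀ h1, zpow_add_one₀ h2]
  ring

lemma aux_pow {R : ℝ} (hR : 0 < R) (n : ℤ) :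
    (∮ w in C(0, R), w ^ n) = if n = -1 then 2 * (π : ℂ) * I else 0 := by
  split_ifs with h
  · subst h
    have := circleIntegral.integral_sub_center_inv 0 hR.ne'
    simpa using this
  · have := circleIntegral.integral_sub_zpow_of_ne h 0 0 R
    simpa using this

lemma aux_I {R : ℝ} {u : ℂ} (hu : ‖u‖ < R) (n : ℕ) :
    (∮ w in C(0, R), w ^ (n : ℤ) * (w - u) ^ (-1 : ℤ)) = 2 * (π : ℂ) * I * u ^ n := by
  have hR : 0 < R := (norm_nonneg u).trans_lt hu
  induction n with
  | zero =>
    have := circleIntegral.integral_sub_inv_of_mem_ball (c := 0) (w := u) (R := R) (by simpa using hu)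
    simpa using this
  | succ n ih =>
    push_cast
    rw [aux_rec hu, ih]
    have := aux_pow hR (n : ℤ)
    rw [if_neg (by omega)] at this
    simp only [show (-1 : ℤ) + 1 = 0 by norm_num, zpow_zero, mul_one, this]
    ring

lemma aux_Ineg {R : ℝ} {u : ℂ} (hu : ‖u‖ < R) (hu0 : u ≠ 0) (n : ℕ) :
    (∮ w in C(0, R), w ^ (-(n : ℤ) - 1) * (w - u) ^ (-1 : ℤ)) = 0 := by
  have hR : 0 < R := (norm_nonneg u).trans_lt hu
  induction n with
  | zero =>
    have h := aux_rec hu (-1) (-1)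
    have h0 := aux_I hu 0
    have := aux_pow hR (-1 : ℤ)
    rw [if_pos rfl] at this
    simp only [show (-1 : ℤ) + 1 = 0 by norm_num, zpow_zero, mul_one, this] at h
    simp only [Nat.cast_zero, zpow_zero, pow_zero, mul_one] at h0
    rw [h0] at h
    have : u * (∮ w in C(0, R), w ^ (-1 : ℤ) * (w - u) ^ (-1 : ℤ)) = 0 := by
      linear_combination -h
    simpa [hu0] using this
  | succ n ih =>
    have h := aux_rec hu (-((n + 1 : ℕ) : ℤ) - 1) (-1)
    rw [show (-((n + 1 : ℕ) : ℤ) - 1) + 1 = -(n : ℤ) - 1 by push_cast; ring, ih] at h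
    have := aux_pow hR (-((n + 1 : ℕ) : ℤ) - 1)
    rw [if_neg (by push_cast; omega)] at this
    simp only [show (-1 : ℤ) + 1 = 0 by norm_num, zpow_zero, mul_one, this, add_zero] at h
    have h := h.symm
    simpa [hu0] using h

lemma aux_J {R : ℝ} {u : ℂ} (hu : ‖u‖ < R) (n : ℕ) :
    (∮ w in C(0, R), w ^ (n : ℤ) * (w - u) ^ (-2 : ℤ)) = 2 * (π : ℂ) * I * (n * u ^ (n - 1)) := by
  induction n with
  | zero =>
    have := circleIntegral.integral_sub_zpow_of_ne (n := -2) (by norm_num) 0 u R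
    simpa using this
  | succ n ih =>
    push_cast
    rw [aux_rec hu, ih, show (-2 : ℤ) + 1 = -1 by norm_num, aux_I hu]
    rcases n with _ | n
    · simp
    · simp only [Nat.add_sub_cancel]
      push_cast
      ring

lemma aux_Jneg {R : ℝ} {u : ℂ} (hu : ‖u‖ < R) (n : ℕ) :
    (∮ w in C(0, R), w ^ (-(n : ℤ)) * (w - u) ^ (-2 : ℤ)) = 0 := by
  have hR : 0 < R := (norm_nonneg u).trans_lt hu
  by_cases hu0 : u = 0
  · subst hu0
    have h := aux_pow hR (-(n : ℤ) - 2)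
    rw [if_neg (by omega)] at h
    refine Eq.trans ?_ h
    refine circleIntegral.integral_congr hR.le fun w hw => ?_
    obtain ⟨h1, h2⟩ := aux_ne hu hw
    simp only [sub_zero]
    rw [← zpow_add₀ h1]
    rfl
  induction n with
  | zero => simpa using aux_J hu 0
  | succ n ih =>
    have h := aux_rec hu (-((n + 1 : ℕ) : ℤ)) (-2)
    rw [show (-((n + 1 : ℕ) : ℤ)) + 1 = -(n : ℤ) by push_cast; ring, ih,
      show (-2 : ℤ) + 1 = -1 by norm_num] at h
    have h2 := aux_Ineg hu hu0 n
    rw [show -(n : ℤ) - 1 = (-((n + 1 : ℕ) : ℤ)) by push_cast; ring] at h2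
    rw [h2, add_zero] at h
    have h := h.symm
    simpa [hu0] using h

/-- inner integral -/
lemma aux_inner {R : ℝ} {u : ℂ} (hu : ‖u‖ < R) (k : ℕ) (b : ℂ) :
    (∮ w in C(0, R), (w + b / w) ^ k * ((u - w) ^ 2)⁻¹) =
      ∑ r ∈ Finset.Icc 1 k, if r % 2 = k % 2 then
        (k.choose ((k - r) / 2) : ℂ) * b ^ ((k - r) / 2) * (2 * (π : ℂ) * I * (r * u ^ (r - 1)))
        else 0 := by
  have hR : 0 < R := (norm_nonneg u).trans_lt hu
  have h1 : (∮ w in C(0, R), (w + b / w) ^ k * ((u - w) ^ 2)⁻¹) =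
      ∮ w in C(0, R), ∑ j ∈ Finset.range (k + 1),
      ((k.choose j : ℂ) * b ^ j) * (w ^ ((k : ℤ) - 2 * j) * (w - u) ^ (-2 : ℤ)) := by
    refine circleIntegral.integral_congr hR.le fun w hw => ?_
    obtain ⟨h1, h2⟩ := aux_ne hu hw
    rw [aux_expand k b w h1, Finset.sum_mul]
    refine Finset.sum_congr rfl fun j _ => ?_
    rw [show (w - u) ^ (-2 : ℤ) = ((u - w) ^ 2)⁻¹ by
      rw [zpow_neg, show (u - w) ^ 2 = (w - u) ^ 2 by ring]; rfl]
    ring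
  rw [h1, aux_sum _ _ _ (fun j => aux_int hu _ _)]
  rw [← Finset.sum_filter]
  symm
  refine Finset.sum_of_injOn (fun r => (k - r) / 2) ?_ ?_ ?_ ?_
  · intro r hr s hs h
    simp at hr hs h
    omega
  · intro r hr
    simp at hr ⊢
    omega
  · intro j hj hj'
    simp at hj hj'
    have : 2 * j ≥ k := by
      by_contra hcon
      exact hj' (k - 2 * j) (by omega) (by omega) (by omega) (by omega)
    have h2 := aux_Jneg hu (2 * j - k)
    rw [show -((2 * j - k : ℕ) : ℤ) = (k : ℤ) - 2 * j by omega] at h2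
    rw [h2, mul_zero]
  · intro r hr
    simp at hr
    rw [show (k : ℤ) - 2 * ((k - r) / 2 : ℕ) = r by omega, aux_J hu]

/-- outer integral -/
lemma aux_outer {R : ℝ} (hR : 0 < R) (k r : ℕ) (hr : 1 ≤ r) (b : ℂ) :
    (∮ z in C(0, R), (z + b / z) ^ k * z ^ (r - 1)) =
      if r ≤ k ∧ r % 2 = k % 2 then
        (k.choose ((k - r) / 2) : ℂ) * b ^ ((k - r) / 2 + r) * (2 * (π : ℂ) * I) else 0 := by
  have hu : ‖(0 : ℂ)‖ < R := by simpa using hR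
  have h1 : (∮ z in C(0, R), (z + b / z) ^ k * z ^ (r - 1)) =
      ∮ z in C(0, R), ∑ j ∈ Finset.range (k + 1),
      ((k.choose j : ℂ) * b ^ j) * (z ^ ((k : ℤ) - 2 * j + (r - 1))) := by
    refine circleIntegral.integral_congr hR.le fun z hz => ?_
    obtain ⟨h1, h2⟩ := aux_ne hu hz
    rw [aux_expand k b z h1, Finset.sum_mul]
    refine Finset.sum_congr rfl fun j _ => ?_
    rw [zpow_add₀ h1, show (r : ℤ) - 1 = ((r - 1 : ℕ) : ℤ) by omega, zpow_natCast]
    ring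
  have hint : ∀ n : ℤ, CircleIntegrable (fun z : ℂ => z ^ n) 0 R := fun n => by
    simpa using aux_int hu n 0
  rw [h1, aux_sum _ _ _ (fun j => hint _)]
  simp only [aux_pow hR]
  split_ifs with h
  · obtain ⟨h1, h2⟩ := h
    rw [Finset.sum_eq_single ((k - r) / 2 + r)]
    · rw [if_pos (by omega)]
      congr 3
      rw [← Nat.choose_symm (by omega)]
      congr 1
      omega
    · intro j _ hj
      rw [if_neg (by omega), mul_zero]
    · intro hj
      simp at hj
      omega
  · refine Finset.sum_eq_zero fun j hj => ?_
    simp at hj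
    rw [if_neg (by omega), mul_zero]

/-- `S(k,k',b,b',c)` as a double contour integral over circles of radii `ρ₁ < ρ₂`:
`S = −(1/(2π²)) ∮_{|z|=ρ₁} ∮_{|w|=ρ₂} (z + b/z)^k (w + b'/w)^{k'} (c/b) ((c/b)z − w)^{−2} dw dz`. -/
theorem S_eq_double_contour_integral (k k' : ℕ) (hk : 1 ≤ k) (hk' : 1 ≤ k')
    (b b' c : ℝ) (hb : 0 < b) (hb' : 0 < b') (hc0 : 0 ≤ c) (hcb : c ≤ b)
    (ρ₁ ρ₂ : ℝ) (hρ₁ : 0 < ρ₁) (hρ : ρ₁ < ρ₂) :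
    (Sker k k' b b' c : ℂ) =
      -(1 / (2 * (Real.pi : ℂ) ^ 2)) *
        ∮ z in C(0, ρ₁), ∮ w in C(0, ρ₂),
          (z + (b : ℂ) / z) ^ k * (w + (b' : ℂ) / w) ^ k' *
            ((c : ℂ) / (b : ℂ)) * ((((c : ℂ) / (b : ℂ)) * z - w) ^ 2)⁻¹ := by
  have hbC : (b : ℂ) ≠ 0 := by exact_mod_cast hb.ne'
  set a : ℂ := (c : ℂ) / (b : ℂ) with ha
  have han : ‖a‖ ≤ 1 := by
    rw [ha, ← Complex.ofReal_div, Complex.norm_real, Real.norm_eq_abs,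
      abs_of_nonneg (div_nonneg hc0 hb.le), div_le_one hb]
    exact hcb
  have h1 : (∮ z in C(0, ρ₁), ∮ w in C(0, ρ₂),
      (z + (b : ℂ) / z) ^ k * (w + (b' : ℂ) / w) ^ k' * a * ((a * z - w) ^ 2)⁻¹) =
      ∮ z in C(0, ρ₁), ∑ r ∈ Finset.Icc 1 k',
        (if r % 2 = k' % 2 then
          (k'.choose ((k' - r) / 2) : ℂ) * (b' : ℂ) ^ ((k' - r) / 2) *
            (2 * (π : ℂ) * I * (r * a ^ r)) else 0) *
        ((z + (b : ℂ) / z) ^ k * z ^ (r - 1)) := by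
    refine circleIntegral.integral_congr hρ₁.le fun z hz => ?_
    have hz' : ‖z‖ = ρ₁ := by simpa using hz
    have hu : ‖a * z‖ < ρ₂ := by
      rw [norm_mul, hz']
      nlinarith
    have h2 := aux_inner hu k' (b' : ℂ)
    have h3 : (∮ w in C(0, ρ₂),
      (z + (b : ℂ) / z) ^ k * (w + (b' : ℂ) / w) ^ k' * a * ((a * z - w) ^ 2)⁻¹) =
      ((z + (b : ℂ) / z) ^ k * a) * ∮ w in C(0, ρ₂),
        (w + (b' : ℂ) / w) ^ k' * ((a * z - w) ^ 2)⁻¹ := by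
      rw [← circleIntegral.integral_const_mul]
      congr 1
      ext w
      ring
    rw [h3, h2, Finset.mul_sum]
    refine Finset.sum_congr rfl fun r hr => ?_
    have hr1 : 1 ≤ r := (Finset.mem_Icc.mp hr).1
    split_ifs
    · obtain ⟨s, rfl⟩ : ∃ s, r = s + 1 := ⟨r - 1, by omega⟩
      simp only [Nat.add_sub_cancel]
      ring
    · simp
  have hint : ∀ r : ℕ, CircleIntegrable
      (fun z : ℂ => (z + (b : ℂ) / z) ^ k * z ^ (r - 1)) 0 ρ₁ := by
    intro r
    apply ContinuousOn.circleIntegrable hρ₁.le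
    intro z hz
    obtain ⟨hz0, -⟩ := aux_ne (u := 0) (by simpa using hρ₁) hz
    apply ContinuousAt.continuousWithinAt
    fun_prop (disch := assumption)
  rw [h1, aux_sum _ _ _ hint]
  rw [Sker, Complex.ofReal_sum, Finset.mul_sum]
  refine Finset.sum_subset_zero_on_sdiff ?_ ?_ ?_
  · intro r hr
    simp at hr ⊢
    omega
  · intro r hr
    simp at hr
    rw [aux_outer hρ₁ k r (by omega), if_neg (show ¬ (r ≤ k ∧ r % 2 = k % 2) by omega)]
    simp
  · intro r hr
    simp at hr
    rw [aux_outer hρ₁ k r (by omega)]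
    by_cases h : r % 2 = k % 2 ∧ r % 2 = k' % 2
    · rw [if_pos h, if_pos h.2, if_pos ⟨by omega, h.1⟩]
      have hπ : (π : ℂ) ≠ 0 := by exact_mod_cast Real.pi_ne_zero
      have hab : (c : ℂ) ^ r = a ^ r * (b : ℂ) ^ r := by
        rw [← mul_pow, ha, div_mul_cancel₀ _ hbC]
      push_cast
      rw [hab, pow_add]
      field_simp
      ring_nf
      simp only [I_sq]
      ring
    · rw [if_neg h]
      by_cases h' : r % 2 = k' % 2
      · rw [if_neg (show ¬ (r ≤ k ∧ r % 2 = k % 2) from fun hh => h ⟨hh.2, h'⟩)]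
        simp
      · rw [if_neg h']
        simp
end

section
/- Let k, k' ≥ 1 be integers and let b, b', c be real numbers. Then A₁ + A₂ + A₃ = S(k, k', b, b', c), where: A₁ = 2·k·k'·Catalan((k−1)/2)·Catalan((k'−1)/2)·c·b^{(k−1)/2}·(b')^{(k'−1)/2} if both k and k' are odd, and A₁ = 0 otherwise; A₂ = k·k'·Catalan(k/2)·Catalan(k'/2)·c²·b^{k/2−1}·(b')^{k'/2−1} if both k and k' are even, and A₂ = 0 otherwise; A₃ = Σ_{r=3}^{min(k,k')} (2·k·k'/r) · ( Σ_{(s_1,…,s_r) ∈ ℕ^r, 2(s_1+⋯+s_r) = k−r} Catalan(s_1)⋯Catalan(s_r) ) · ( Σ_{(t_1,…,t_r) ∈ ℕ^r, 2(t_1+⋯+t_r) = k'−r} Catalan(t_1)⋯Catalan(t_r) ) · c^r · b^{(k−r)/2} · (b')^{(k'−r)/2}, where the inner sums are empty (hence zero) when k−r or k'−r is odd or negative. -/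
/-- Sum over tuples `(s₁,…,s_r) ∈ ℕ^r` with `2(s₁+⋯+s_r) = k − r` of
`Catalan(s₁)⋯Catalan(s_r)`; it is zero when `k − r` is odd or negative. -/
noncomputable def catalanTupleSum (r k : ℕ) : ℝ :=
  if r ≤ k ∧ (k - r) % 2 = 0 then
    ∑ s ∈ Finset.Nat.antidiagonalTuple r ((k - r) / 2), ∏ i, (catalan (s i) : ℝ)
  else 0

open PowerSeries in
/-- Number-theoretic core: coefficients of powers of the Catalan series. -/
lemma coeff_catalanSeries_pow_succ (r n : ℕ) :
    coeff (n + 1) (catalanSeries ^ (r + 1)) =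
      coeff (n + 1) (catalanSeries ^ r) + coeff n (catalanSeries ^ (r + 2)) := by
  have h : catalanSeries ^ (r + 1) = catalanSeries ^ r + catalanSeries ^ (r + 2) * X := by
    calc catalanSeries ^ (r + 1) = catalanSeries ^ r * catalanSeries := pow_succ _ _
      _ = catalanSeries ^ r * (catalanSeries ^ 2 * X + 1) := by
          rw [catalanSeries_sq_mul_X_add_one]
      _ = _ := by ring
  rw [h, map_add, coeff_succ_mul_X]

open PowerSeries in
lemma coeff_catalanSeries_pow (n r : ℕ) :
    (2 * n + r) * coeff n (catalanSeries ^ r) = r * (2 * n + r).choose n := by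
  induction n generalizing r with
  | zero => simp
  | succ n ihn =>
    induction r with
    | zero => simp
    | succ r ihr =>
      rw [coeff_catalanSeries_pow_succ]
      have h1 := ihn (r + 2)
      set x := coeff (n + 1) (catalanSeries ^ r)
      set y := coeff n (catalanSeries ^ (r + 2))
      have e1 : 2 * (n + 1) + r = 2 * n + r + 2 := by ring
      have e2 : 2 * n + (r + 2) = 2 * n + r + 2 := by ring
      have e3 : 2 * (n + 1) + (r + 1) = (2 * n + r + 2) + 1 := by ring
      rw [e1] at ihr
      rw [e2] at h1
      rw [e3, Nat.choose_succ_succ]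
      have h2 := Nat.choose_succ_right_eq (2 * n + r + 2) n
      have e4 : 2 * n + r + 2 - n = n + r + 2 := by omega
      rw [e4] at h2
      set p := (2 * n + r + 2).choose n
      set q := (2 * n + r + 2).choose (n + 1)
      have hpos : 0 < 2 * n + r + 2 := by omega
      apply Nat.eq_of_mul_eq_mul_left hpos
      zify at *
      linear_combination (2 * n + r + 3 : ℤ) * ihr + (2 * n + r + 3 : ℤ) * h1 - 2 * h2

lemma sum_antidiagonalTuple_succ (r n : ℕ) (f : (Fin (r + 1) → ℕ) → ℕ) :
    ∑ s ∈ Finset.Nat.antidiagonalTuple (r + 1) n, f s =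
      ∑ ij ∈ Finset.HasAntidiagonal.antidiagonal n, ∑ s ∈ Finset.Nat.antidiagonalTuple r ij.2,
        f (Fin.cons ij.1 s) := by
  rw [Finset.sum_sigma']
  symm
  refine Finset.sum_bij' (fun x _ => (Fin.cons x.1.1 x.2 : Fin (r + 1) → ℕ))
    (fun s _ => ⟨(s 0, ∑ i, Fin.tail s i), Fin.tail s⟩) ?_ ?_ ?_ ?_ ?_
  · rintro ⟨⟨a, b⟩, s⟩ h
    simp only [Finset.mem_sigma, Finset.HasAntidiagonal.mem_antidiagonal, Finset.Nat.mem_antidiagonalTuple] at h ⊢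
    rw [Fin.sum_univ_succ]
    simp only [Fin.cons_zero, Fin.cons_succ]
    omega
  · intro s h
    simp only [Finset.mem_sigma, Finset.HasAntidiagonal.mem_antidiagonal, Finset.Nat.mem_antidiagonalTuple] at h ⊢
    rw [Fin.sum_univ_succ] at h
    exact ⟨h, trivial⟩
  · rintro ⟨⟨a, b⟩, s⟩ h
    simp only [Finset.mem_sigma, Finset.HasAntidiagonal.mem_antidiagonal, Finset.Nat.mem_antidiagonalTuple] at h
    obtain ⟨h1, h2⟩ := h
    subst h2
    simp
  · intro s h
    simp
  · intro x h
    rfl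

open PowerSeries in
lemma sum_tuple_eq_coeff (r n : ℕ) :
    ∑ s ∈ Finset.Nat.antidiagonalTuple r n, ∏ i, catalan (s i) =
      coeff n (catalanSeries ^ r) := by
  induction r generalizing n with
  | zero => cases n <;> simp [coeff_one]
  | succ r ih =>
    rw [sum_antidiagonalTuple_succ, pow_succ', coeff_mul]
    refine Finset.sum_congr rfl fun ij _ => ?_
    rw [← ih, catalanSeries_coeff, Finset.mul_sum]
    refine Finset.sum_congr rfl fun s _ => ?_
    rw [Fin.prod_univ_succ]
    simp

lemma mul_catalanTupleSum (r n : ℕ) :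
    ((2 * n + r : ℕ) : ℝ) * catalanTupleSum r (2 * n + r) = r * ((2 * n + r).choose n : ℝ) := by
  have h : r ≤ 2 * n + r ∧ (2 * n + r - r) % 2 = 0 := by omega
  have e : (2 * n + r - r) / 2 = n := by omega
  rw [catalanTupleSum, if_pos h, e]
  have h2 := sum_tuple_eq_coeff r n
  have h3 := coeff_catalanSeries_pow n r
  rw [← h2] at h3
  exact_mod_cast h3

lemma term_eq (k k' r : ℕ) (hr : 1 ≤ r) (hk : r ≤ k) (hk' : r ≤ k') (b b' c : ℝ) :
    (2 * k * k' / r : ℝ) * catalanTupleSum r k * catalanTupleSum r k' *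
          c ^ r * b ^ ((k - r) / 2) * b' ^ ((k' - r) / 2) =
    if r % 2 = k % 2 ∧ r % 2 = k' % 2 then
      2 * r * (k.choose ((k - r) / 2)) * (k'.choose ((k' - r) / 2)) *
        c ^ r * b ^ ((k - r) / 2) * b' ^ ((k' - r) / 2)
    else (0 : ℝ) := by
  split_ifs with h
  · obtain ⟨n, rfl⟩ : ∃ n, k = 2 * n + r := ⟨(k - r) / 2, by omega⟩
    obtain ⟨m, rfl⟩ : ∃ m, k' = 2 * m + r := ⟨(k' - r) / 2, by omega⟩
    have e : (2 * n + r - r) / 2 = n := by omega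
    have e' : (2 * m + r - r) / 2 = m := by omega
    rw [e, e']
    have h1 := mul_catalanTupleSum r n
    have h2 := mul_catalanTupleSum r m
    have hr0 : (r : ℝ) ≠ 0 := by positivity
    calc _ = (2 / r : ℝ) * (((2 * n + r : ℕ) : ℝ) * catalanTupleSum r (2 * n + r)) *
          (((2 * m + r : ℕ) : ℝ) * catalanTupleSum r (2 * m + r)) * c ^ r * b ^ n * b' ^ m := by
          ring
      _ = _ := by
          rw [h1, h2]
          field_simp
  · by_cases h1 : r % 2 = k % 2
    · have : catalanTupleSum r k' = 0 := by
        rw [catalanTupleSum, if_neg]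
        omega
      simp [this]
    · have : catalanTupleSum r k = 0 := by
        rw [catalanTupleSum, if_neg]
        omega
      simp [this]

lemma catalanTupleSum_one (k : ℕ) (h : k % 2 = 1) :
    catalanTupleSum 1 k = catalan ((k - 1) / 2) := by
  rw [catalanTupleSum, if_pos (by omega)]
  simp

lemma catalanTupleSum_two (k : ℕ) (hk : 1 ≤ k) (h : k % 2 = 0) :
    catalanTupleSum 2 k = catalan (k / 2) := by
  obtain ⟨n, rfl⟩ : ∃ n, k = 2 * (n + 1) := ⟨k / 2 - 1, by omega⟩
  rw [catalanTupleSum, if_pos (by omega)]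
  have e : (2 * (n + 1) - 2) / 2 = n := by omega
  have e2 : 2 * (n + 1) / 2 = n + 1 := by omega
  rw [e, e2, catalan_succ', Finset.Nat.antidiagonalTuple_two]
  simp [Fin.prod_univ_succ]

lemma sum_Icc_split (m : ℕ) (hm : 1 ≤ m) (f : ℕ → ℝ) :
    ∑ r ∈ Finset.Icc 1 m, f r =
      f 1 + (if 2 ≤ m then f 2 else 0) + ∑ r ∈ Finset.Icc 3 m, f r := by
  rw [← Finset.add_sum_Ioc_eq_sum_Icc hm]
  have e : Finset.Ioc 1 m = Finset.Icc 2 m := by ext; simp; omega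
  rw [e]
  split_ifs with h
  · rw [← Finset.add_sum_Ioc_eq_sum_Icc h]
    have e : Finset.Ioc 2 m = Finset.Icc 3 m := by ext; simp; omega
    rw [e]
    ring
  · rw [Finset.Icc_eq_empty (by omega), Finset.Icc_eq_empty (by omega)]
    simp

/-- The three Catalan-number terms of the asymptotic covariance sum to
`S(k, k', b, b', c)`. -/
theorem catalan_terms_eq_S (k k' : ℕ) (hk : 1 ≤ k) (hk' : 1 ≤ k') (b b' c : ℝ) :
    (if k % 2 = 1 ∧ k' % 2 = 1 then
        2 * k * k' * (catalan ((k - 1) / 2) : ℝ) * (catalan ((k' - 1) / 2) : ℝ) *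
          c * b ^ ((k - 1) / 2) * b' ^ ((k' - 1) / 2)
      else 0) +
      (if k % 2 = 0 ∧ k' % 2 = 0 then
        (k : ℝ) * k' * (catalan (k / 2) : ℝ) * (catalan (k' / 2) : ℝ) *
          c ^ 2 * b ^ (k / 2 - 1) * b' ^ (k' / 2 - 1)
      else 0) +
      (∑ r ∈ Finset.Icc 3 (min k k'),
        (2 * k * k' / r : ℝ) * catalanTupleSum r k * catalanTupleSum r k' *
          c ^ r * b ^ ((k - r) / 2) * b' ^ ((k' - r) / 2)) =
    Sker k k' b b' c := by
  rw [Sker, sum_Icc_split _ (by omega)]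
  congr 1
  · congr 1
    · rw [← term_eq k k' 1 le_rfl hk hk']
      split_ifs with h
      · rw [catalanTupleSum_one k h.1, catalanTupleSum_one k' h.2]
        simp
      · rw [term_eq k k' 1 le_rfl hk hk', if_neg (by omega)]
    · by_cases h : k % 2 = 0 ∧ k' % 2 = 0
      · rw [if_pos h, if_pos (by omega), ← term_eq k k' 2 (by omega) (by omega) (by omega),
          catalanTupleSum_two k hk h.1, catalanTupleSum_two k' hk' h.2]
        have e : (k - 2) / 2 = k / 2 - 1 := by omega
        have e' : (k' - 2) / 2 = k' / 2 - 1 := by omega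
        rw [e, e']
        push_cast
        ring
      · rw [if_neg h]
        split_ifs with h1 h2
        · omega
        · rfl
        · rfl
  · refine Finset.sum_congr rfl fun r hr => ?_
    rw [Finset.mem_Icc] at hr
    exact term_eq k k' r (by omega) (by omega) (by omega) b b' c
end
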